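/- Let 0 < α < 1. For any λ > 1/(2πα) and any 0 < μ ≤ 1 there exists a constant C_λ > 0 (independent of μ) such that every function u ∈ H¹(ℝ²) that is α-Hölder continuous and not identically zero satisfies ‖u‖²_{L^∞} ≤ λ ‖u‖²_{H_μ} · log( C_λ + 8^α μ^{−α} ‖u‖_{C^α} / ‖u‖_{H_μ} ). -/

import Mathlib

open MeasureTheory Real Classical
open scoped ENNReal RealInnerProductSpace

noncomputable section

/-- The plane `ℝ²`. -/
abbrev Plane := EuclideanSpace ℝ (Fin 2)

/-- Pointwise norm of the (full) gradient of `u`. -/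
def gradNorm (u : Plane → ℝ) (x : Plane) : ℝ := ‖fderiv ℝ u x‖

/-- The `L^p` norm for a real (finite) exponent `p`. -/
def LpNorm (p : ℝ) (u : Plane → ℝ) : ℝ := (∫ x : Plane, |u x| ^ p) ^ (1 / p)

/-- The sup (`L^∞`) norm. -/
def supNorm (u : Plane → ℝ) : ℝ := ⨆ x : Plane, |u x|

/-- The homogeneous Hölder seminorm `[u]_α`. -/
def holderSemi (α : ℝ) (u : Plane → ℝ) : ℝ :=
  ⨆ p : Plane × Plane,
    if p.1 = p.2 then 0 else |u p.1 - u p.2| / ‖p.1 - p.2‖ ^ α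

/-- The Hölder norm `‖u‖_{C^α} = sup |u| + [u]_α`. -/
def holderNorm (α : ℝ) (u : Plane → ℝ) : ℝ := supNorm u + holderSemi α u

/-- `u` is `α`-Hölder continuous. -/
def IsHolder (α : ℝ) (u : Plane → ℝ) : Prop :=
  ∃ C : ℝ, 0 ≤ C ∧ ∀ x y : Plane, |u x - u y| ≤ C * ‖x - y‖ ^ α

/-- The squared `H¹` norm `‖∇u‖_{L²}² + ‖u‖_{L²}²`. -/
def H1Sq (u : Plane → ℝ) : ℝ :=
  (∫ x : Plane, gradNorm u x ^ 2) + ∫ x : Plane, u x ^ 2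

/-- The squared local `H¹` norm `‖u‖_{H¹[R]}²`. -/
def H1locSq (R : ℝ) (u : Plane → ℝ) : ℝ :=
  ⨆ c : Plane, ∫ x in Metric.closedBall c R, (gradNorm u x ^ 2 + u x ^ 2)

/-- Membership in `H¹(ℝ²)` (with classical derivatives). -/
def MemH1 (u : Plane → ℝ) : Prop :=
  Differentiable ℝ u ∧ Integrable (fun x => u x ^ 2) ∧
    Integrable (fun x => gradNorm u x ^ 2)

/-- The nonlinearity `f(u) = (e^{4π u²} - 1 - 4π u²) u`. -/
def f (s : ℝ) : ℝ := (Real.exp (4 * π * s ^ 2) - 1 - 4 * π * s ^ 2) * s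

/-- The potential `F(u) = (1/8π)(e^{4π u²} - 1 - 4π u² - 8π² u⁴)`. -/
def F (s : ℝ) : ℝ :=
  (8 * π)⁻¹ * (Real.exp (4 * π * s ^ 2) - 1 - 4 * π * s ^ 2 - 8 * π ^ 2 * s ^ 4)

/-- The squared `H_μ` norm `‖∇u‖_{L²}² + μ²‖u‖_{L²}²`. -/
def HmuSq (μ : ℝ) (u : Plane → ℝ) : ℝ :=
  (∫ x : Plane, gradNorm u x ^ 2) + μ ^ 2 * ∫ x : Plane, u x ^ 2

open Set in
/-- First moment method in polar coordinates: some ray issuing from `x₀` carries at most the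
average share of the integral. -/
lemma exists_ray_integral_le {h : Plane → ℝ} (h0 : ∀ x, 0 ≤ h x) (hm : Measurable h)
    (hi : Integrable h) (x₀ : Plane) :
    ∃ ω : Plane, ‖ω‖ = 1 ∧ IntegrableOn (fun s : ℝ => s * h (x₀ + s • ω)) (Ioi 0) ∧
      ∫ s in Ioi (0 : ℝ), s * h (x₀ + s • ω) ≤ (∫ x, h x) / (2 * π) := by
  let ι : ℂ ≃ₗᵢ[ℝ] Plane := Complex.orthonormalBasisOneI.repr
  let e : ℝ → Plane := fun θ => ι (Real.cos θ + Real.sin θ * Complex.I)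
  have he : ∀ θ, ‖e θ‖ = 1 := fun θ => by
    simp only [e, LinearIsometryEquiv.norm_map]
    simpa only [Complex.polarCoord_symm_apply, Complex.ofReal_one, one_mul, abs_one]
      using Complex.norm_polarCoord_symm (1, θ)
  have hec : Continuous e := by
    simp only [e]
    exact ι.continuous.comp (by fun_prop)
  let G : ℝ × ℝ → ℝ≥0∞ := fun p => ENNReal.ofReal (p.1 * h (x₀ + p.1 • e p.2))
  have hG : Measurable G := by
    have : Continuous fun p : ℝ × ℝ => x₀ + p.1 • e p.2 := by fun_prop
    exact (measurable_fst.mul (hm.comp this.measurable)).ennreal_ofReal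
  have key : ∫⁻ θ in Ioo (-π) π, ∫⁻ s in Ioi (0 : ℝ), G (s, θ) = ENNReal.ofReal (∫ x, h x) := by
    rw [← setLIntegral_prod_symm G hG.aemeasurable, ← Measure.volume_eq_prod,
      ofReal_integral_eq_lintegral_ofReal hi (ae_of_all _ h0),
      ← lintegral_add_left_eq_self _ x₀,
      ← (LinearIsometryEquiv.measurePreserving ι).lintegral_comp_emb
        ι.toHomeomorph.measurableEmbedding,
      ← Complex.lintegral_comp_polarCoord_symm]
    refine setLIntegral_congr_fun polarCoord.open_target.measurableSet fun p hp => ?_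
    have hp1 : 0 < p.1 := hp.1
    have : ι (Complex.polarCoord.symm p) = p.1 • e p.2 := by
      rw [Complex.polarCoord_symm_apply, ← Complex.real_smul, map_smul]
    simp only [G, this, smul_eq_mul, ENNReal.ofReal_mul hp1.le]
  obtain ⟨θ, -, hθ⟩ := exists_le_setLAverage (μ := volume) (s := Ioo (-π) π)
    (f := fun θ => ∫⁻ s in Ioi (0 : ℝ), G (s, θ))
    (by simp [pi_pos]) (by simp) (hG.lintegral_prod_left').aemeasurable
  have hvol : volume (Ioo (-π) π) = ENNReal.ofReal (2 * π) := by
    rw [Real.volume_Ioo]; congr 1; ring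
  rw [setLAverage_eq, key, hvol, ← ENNReal.ofReal_div_of_pos (by positivity)] at hθ
  have hint : 0 ≤ ∫ x, h x := integral_nonneg h0
  have hmeas : Measurable fun s : ℝ => s * h (x₀ + s • e θ) := by
    have : Continuous fun s : ℝ => x₀ + s • e θ := by fun_prop
    exact measurable_id.mul (hm.comp this.measurable)
  have hnn : 0 ≤ᵐ[volume.restrict (Ioi (0 : ℝ))] fun s : ℝ => s * h (x₀ + s • e θ) := by
    filter_upwards [ae_restrict_mem measurableSet_Ioi] with s hs
    exact mul_nonneg (le_of_lt hs) (h0 _)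
  refine ⟨e θ, he θ, ⟨hmeas.aestronglyMeasurable, ?_⟩, ?_⟩
  · rw [hasFiniteIntegral_iff_ofReal hnn]
    exact hθ.trans_lt ENNReal.ofReal_lt_top
  · rw [integral_eq_lintegral_of_nonneg_ae hnn hmeas.aestronglyMeasurable]
    exact ENNReal.toReal_le_of_le_ofReal (by positivity) hθ

open Set in
/-- One-dimensional estimate along a ray, where `g` dominates the derivative of `φ`. -/
lemma le_of_weighted_integrals {φ φ' g : ℝ → ℝ} {r m N t : ℝ} (hr : 0 < r) (hrm : r ≤ m)
    (hN : 0 < N) (ht : 0 < t) (hd : ∀ s, HasDerivAt φ (φ' s) s) (hle : ∀ s, |φ' s| ≤ g s)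
    (hg : IntegrableOn (fun s => s * g s ^ 2) (Ioi 0))
    (hφ : IntegrableOn (fun s => s * φ s ^ 2) (Ioi 0)) :
    φ r ≤ Real.log (2 * m / r) / (2 * t) + t / 2 * (∫ s in Ioi 0, s * g s ^ 2) + N / 2
      + 1 / (2 * N * m ^ 2) * ∫ s in Ioi 0, s * φ s ^ 2 := by
  have hm : 0 < m := hr.trans_le hrm
  set A := ∫ s in Ioi 0, s * g s ^ 2
  set B := ∫ s in Ioi 0, s * φ s ^ 2
  set L := Real.log (2 * m / r)
  have step : ∀ R ∈ Icc m (2 * m), φ r ≤ φ R + (L / (2 * t) + t / 2 * A) := by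
    intro R hR
    have hrR : r ≤ R := hrm.trans hR.1
    have hsub : Icc r R ⊆ Ioi 0 := fun s hs => hr.trans_le hs.1
    have hi1 : IntegrableOn (fun s : ℝ => 1 / (2 * t) * s⁻¹) (Icc r R) := by
      refine ContinuousOn.integrableOn_Icc ?_
      exact continuousOn_const.mul (continuousOn_inv₀.mono fun s hs => (hsub hs).ne')
    have hi2 : IntegrableOn (fun s => t / 2 * (s * g s ^ 2)) (Icc r R) :=
      (hg.mono_set hsub).const_mul _
    have hI := intervalIntegral.sub_le_integral_of_hasDeriv_right_of_le (g := fun s => -φ s)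
      (g' := fun s => -φ' s) (φ := fun s => 1 / (2 * t) * s⁻¹ + t / 2 * (s * g s ^ 2)) hrR
      (fun s _ => (hd s).neg.continuousAt.continuousWithinAt)
      (fun s _ => (hd s).neg.hasDerivWithinAt) (hi1.add hi2) (by
        intro s hs
        have hs0 : 0 < s := hr.trans hs.1
        have h1 : -φ' s ≤ g s := (neg_le_abs _).trans (hle s)
        have h2 : 1 / (2 * t) * s⁻¹ + t / 2 * (s * g s ^ 2) - g s
            = (t * s * g s - 1) ^ 2 / (2 * t * s) := by
          field_simp; ring
        have h3 : 0 ≤ (t * s * g s - 1) ^ 2 / (2 * t * s) := by positivity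
        linarith)
    have hi1' : IntervalIntegrable (fun s : ℝ => 1 / (2 * t) * s⁻¹) volume r R :=
      (intervalIntegrable_iff_integrableOn_Icc_of_le hrR).2 hi1
    have hi2' : IntervalIntegrable (fun s => t / 2 * (s * g s ^ 2)) volume r R :=
      (intervalIntegrable_iff_integrableOn_Icc_of_le hrR).2 hi2
    rw [intervalIntegral.integral_add hi1' hi2', intervalIntegral.integral_const_mul,
      intervalIntegral.integral_const_mul, integral_inv_of_pos hr (hr.trans_le hrR),
      intervalIntegral.integral_of_le hrR] at hI
    have hA : ∫ s in Ioc r R, s * g s ^ 2 ≤ A := by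
      refine setIntegral_mono_set hg ?_ (Ioc_subset_Icc_self.trans hsub).eventuallyLE
      filter_upwards [ae_restrict_mem measurableSet_Ioi] with s hs
      exact mul_nonneg (le_of_lt hs) (sq_nonneg _)
    have hL : Real.log (R / r) ≤ L := by
      refine Real.log_le_log (div_pos (hr.trans_le hrR) hr) ?_
      gcongr
      exact hR.2
    have hA' : t / 2 * ∫ s in Ioc r R, s * g s ^ 2 ≤ t / 2 * A := by gcongr
    have hL' : 1 / (2 * t) * Real.log (R / r) ≤ L / (2 * t) := by
      rw [one_div_mul_eq_div]; gcongr
    linarith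
  set D := φ r - (L / (2 * t) + t / 2 * A) - N / 2 with hD
  suffices hs : D ≤ 1 / (2 * N * m ^ 2) * B by linarith
  have hB0 : 0 ≤ B := setIntegral_nonneg measurableSet_Ioi fun s hs =>
    mul_nonneg (le_of_lt hs) (sq_nonneg _)
  rcases le_or_gt D 0 with hD0 | hD0
  · exact hD0.trans (by positivity)
  have hsub : Ioc m (2 * m) ⊆ Ioi 0 := fun s hs => hm.trans hs.1
  have hlow : ∫ s in Ioc m (2 * m), (2 * N * D * m) ≤ ∫ s in Ioc m (2 * m), s * φ s ^ 2 := by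
    refine setIntegral_mono_on (integrableOn_const (by simp)) (hφ.mono_set hsub) measurableSet_Ioc fun s hs => ?_
    have h1 := step s ⟨hs.1.le, hs.2⟩
    have h2 : 2 * N * D ≤ φ s ^ 2 := by nlinarith [sq_nonneg (φ s - N)]
    calc 2 * N * D * m ≤ φ s ^ 2 * s := by
          gcongr
          exact hs.1.le
      _ = _ := mul_comm _ _
  have hup : ∫ s in Ioc m (2 * m), s * φ s ^ 2 ≤ B := by
    refine setIntegral_mono_set hφ ?_ hsub.eventuallyLE
    filter_upwards [ae_restrict_mem measurableSet_Ioi] with s hs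
    exact mul_nonneg (le_of_lt hs) (sq_nonneg _)
  rw [setIntegral_const, Real.volume_real_Ioc_of_le (by linarith), smul_eq_mul] at hlow
  rw [one_div_mul_eq_div, le_div_iff₀ (by positivity)]
  nlinarith

/-- A differentiable function with square-integrable gradient is controlled at a point by its
oscillation at distance `r`, its Dirichlet energy and its `L²` norm. -/
lemma abs_le_of_memH1 {u : Plane → ℝ} (hu : MemH1 u) {r m N t c : ℝ} (hr : 0 < r) (hrm : r ≤ m)
    (hN : 0 < N) (ht : 0 < t) (x₀ : Plane) (hc : ∀ x, ‖x - x₀‖ = r → |u x₀ - u x| ≤ c) :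
    |u x₀| ≤ c + Real.log (2 * m / r) / (2 * t) + N / 2
      + (t / 2 * (∫ x, gradNorm u x ^ 2) + 1 / (2 * N * m ^ 2) * ∫ x, u x ^ 2) / (2 * π) := by
  obtain ⟨hd, hu2, hg2⟩ := hu
  have hm : 0 < m := hr.trans_le hrm
  set a := t / 2
  set b := 1 / (2 * N * m ^ 2)
  have ha : 0 < a := by positivity
  have hb : 0 < b := by positivity
  have hgm : Measurable fun x => gradNorm u x ^ 2 := by
    unfold gradNorm
    exact (measurable_fderiv ℝ u).norm.pow_const 2
  obtain ⟨ω, hω, hi, hle⟩ := exists_ray_integral_le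
    (h := fun x => a * gradNorm u x ^ 2 + b * u x ^ 2) (fun x => by positivity)
    ((hgm.const_mul a).add ((hd.continuous.measurable.pow_const 2).const_mul b))
    ((hg2.const_mul a).add (hu2.const_mul b)) x₀
  rw [integral_add (hg2.const_mul a) (hu2.const_mul b), integral_const_mul,
    integral_const_mul] at hle
  have hray : Continuous fun s : ℝ => x₀ + s • ω := by fun_prop
  have hgi : IntegrableOn (fun s : ℝ => s * gradNorm u (x₀ + s • ω) ^ 2) (Set.Ioi 0) := by
    refine (hi.const_mul a⁻¹).mono'
      (measurable_id.mul (hgm.comp hray.measurable)).aestronglyMeasurable ?_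
    filter_upwards [ae_restrict_mem measurableSet_Ioi] with s hs
    have hs0 : 0 < s := hs
    rw [Real.norm_of_nonneg (by positivity), inv_mul_eq_div, le_div_iff₀ ha]
    have : 0 ≤ s * (b * u (x₀ + s • ω) ^ 2) := by positivity
    linarith
  have hui : IntegrableOn (fun s : ℝ => s * u (x₀ + s • ω) ^ 2) (Set.Ioi 0) := by
    refine (hi.const_mul b⁻¹).mono'
      (measurable_id.mul ((hd.continuous.comp hray).measurable.pow_const 2)).aestronglyMeasurable ?_
    filter_upwards [ae_restrict_mem measurableSet_Ioi] with s hs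
    have hs0 : 0 < s := hs
    rw [Real.norm_of_nonneg (by positivity), inv_mul_eq_div, le_div_iff₀ hb]
    have : 0 ≤ s * (a * gradNorm u (x₀ + s • ω) ^ 2) := by positivity
    linarith
  have hsplit : ∫ s in Set.Ioi (0 : ℝ),
        s * (a * gradNorm u (x₀ + s • ω) ^ 2 + b * u (x₀ + s • ω) ^ 2)
      = a * (∫ s in Set.Ioi (0 : ℝ), s * gradNorm u (x₀ + s • ω) ^ 2)
        + b * ∫ s in Set.Ioi (0 : ℝ), s * u (x₀ + s • ω) ^ 2 := by
    rw [← integral_const_mul, ← integral_const_mul,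
      ← integral_add (hgi.const_mul a) (hui.const_mul b)]
    congr 1 with s
    ring
  rw [hsplit] at hle
  have hder : ∀ s : ℝ, HasDerivAt (fun s : ℝ => u (x₀ + s • ω))
      (fderiv ℝ u (x₀ + s • ω) ω) s := fun s => by
    have h1 : HasDerivAt (fun s : ℝ => x₀ + s • ω) ω s := by
      simpa using ((hasDerivAt_id s).smul_const ω).const_add x₀
    exact (hd _).hasFDerivAt.comp_hasDerivAt s h1
  have hdle : ∀ s : ℝ, |fderiv ℝ u (x₀ + s • ω) ω| ≤ gradNorm u (x₀ + s • ω) := fun s => by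
    simpa [hω, gradNorm] using (fderiv ℝ u (x₀ + s • ω)).le_opNorm ω
  have hpos := le_of_weighted_integrals hr hrm hN ht hder hdle hgi hui
  have hneg := le_of_weighted_integrals hr hrm hN ht (fun s => (hder s).neg)
    (fun s => (abs_neg _).trans_le (hdle s)) hgi (by simpa using hui)
  simp only [Pi.neg_apply, neg_sq] at hneg
  change _ ≤ _ + a * _ + N / 2 + b * _ at hpos hneg
  have hosc := abs_le.1 (hc (x₀ + r • ω) (by simp [norm_smul, hω, abs_of_pos hr]))
  refine abs_le.2 ⟨?_, ?_⟩ <;> linarith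

/-- The `H_μ` norm of a nonzero `H¹` function is positive. -/
lemma HmuSq_pos {u : Plane → ℝ} (hu : MemH1 u) (hne : u ≠ 0) {μ : ℝ} (hμ : 0 < μ) :
    0 < HmuSq μ u := by
  have h1 : 0 ≤ ∫ x, gradNorm u x ^ 2 := integral_nonneg fun x => sq_nonneg _
  have h2 : 0 < ∫ x, u x ^ 2 := by
    rw [integral_pos_iff_support_of_nonneg (fun x => sq_nonneg _) hu.2.1]
    obtain ⟨x, hx⟩ := Function.ne_iff.1 hne
    exact (hu.1.continuous.pow 2).isOpen_support.measure_pos _ ⟨x, pow_ne_zero 2 hx⟩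
  unfold HmuSq
  positivity

/-- The Hölder seminorm bounds the Hölder quotient. -/
lemma IsHolder.abs_sub_le {α : ℝ} {u : Plane → ℝ} (hu : IsHolder α u) {x y : Plane}
    (hxy : x ≠ y) : |u x - u y| ≤ holderSemi α u * ‖x - y‖ ^ α := by
  obtain ⟨C, hC, h⟩ := hu
  have hbdd : BddAbove (Set.range fun p : Plane × Plane =>
      if p.1 = p.2 then 0 else |u p.1 - u p.2| / ‖p.1 - p.2‖ ^ α) := by
    refine ⟨C, ?_⟩
    rintro _ ⟨p, rfl⟩
    dsimp only
    split_ifs with hp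
    · exact hC
    · exact div_le_of_le_mul₀ (by positivity) hC (h _ _)
  have := le_ciSup hbdd (x, y)
  simp only [if_neg hxy] at this
  exact (div_le_iff₀ (Real.rpow_pos_of_pos (norm_pos_iff.2 (sub_ne_zero.2 hxy)) α)).1 this

lemma holderSemi_nonneg (α : ℝ) (u : Plane → ℝ) : 0 ≤ holderSemi α u :=
  Real.iSup_nonneg fun p => by split_ifs <;> positivity

lemma supNorm_nonneg (u : Plane → ℝ) : 0 ≤ supNorm u := Real.iSup_nonneg fun _ => abs_nonneg _

/-- Sup bound with the sharp leading constant `(2π)⁻¹` in front of the logarithm. -/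
lemma supNorm_le_sqrt_log {α μ : ℝ} (hα : 0 < α) (hμ : 0 < μ) {u : Plane → ℝ} (hu : MemH1 u)
    (hh : IsHolder α u) (hne : u ≠ 0) :
    supNorm u ≤ √(HmuSq μ u) * (2 + √((Real.log 2
      + Real.log (max 1 (μ ^ (-α) * holderNorm α u / √(HmuSq μ u))) / α) / (2 * π))) := by
  have hH := HmuSq_pos hu hne hμ
  set N := √(HmuSq μ u) with hNdef
  have hN : 0 < N := Real.sqrt_pos.2 hH
  have hN2 : N ^ 2 = HmuSq μ u := Real.sq_sqrt hH.le
  set X := μ ^ (-α) * holderNorm α u / N with hX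
  set Y := max 1 X
  have hY1 : 1 ≤ Y := le_max_left _ _
  have hY : 0 < Y := by linarith
  set L := Real.log 2 + Real.log Y / α with hL
  have hL0 : 0 < L := by
    have := Real.log_nonneg hY1
    have := Real.log_pos (one_lt_two)
    positivity
  set q := √(L / (2 * π)) with hq
  have hq0 : 0 < q := Real.sqrt_pos.2 (by positivity)
  have hq2 : L = 2 * π * q ^ 2 := by
    rw [hq, Real.sq_sqrt (by positivity)]; field_simp
  set r := μ⁻¹ * Y ^ (-(1 / α)) with hr
  have hr0 : 0 < r := by positivity
  have hrm : r ≤ μ⁻¹ :=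
    mul_le_of_le_one_right (by positivity)
      (Real.rpow_le_one_of_one_le_of_nonpos hY1 (by simp [hα.le]))
  have hrα : r ^ α = μ ^ (-α) / Y := by
    rw [hr, Real.mul_rpow (by positivity) (by positivity), ← Real.rpow_mul hY.le,
      Real.inv_rpow hμ.le, Real.rpow_neg hμ.le]
    have : -(1 / α) * α = -1 := by field_simp
    rw [this, Real.rpow_neg_one, div_eq_mul_inv]
  have hlog : Real.log (2 * μ⁻¹ / r) = L := by
    have : 2 * μ⁻¹ / r = 2 * Y ^ (1 / α) := by
      rw [hr, Real.rpow_neg hY.le]; field_simp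
    rw [this, Real.log_mul (by norm_num) (by positivity), Real.log_rpow hY, hL]
    ring
  have hosc : holderSemi α u * r ^ α ≤ N := by
    have h1 : holderSemi α u ≤ holderNorm α u := le_add_of_nonneg_left (supNorm_nonneg u)
    calc holderSemi α u * r ^ α ≤ holderNorm α u * (μ ^ (-α) / Y) := by rw [hrα]; gcongr
      _ = N * (X / Y) := by rw [hX]; field_simp
      _ ≤ N * 1 := by
        gcongr
        exact (div_le_one hY).2 (le_max_right _ _)
      _ = N := mul_one _
  refine ciSup_le fun x₀ => ?_
  have hb := abs_le_of_memH1 hu hr0 hrm hN (t := 2 * π * q / N) (by positivity) x₀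
    (c := N) fun x hx => by
      have hxx : x₀ ≠ x := by rintro rfl; simp at hx; exact hr0.ne hx
      refine (hh.abs_sub_le hxx).trans ?_
      rwa [norm_sub_rev, hx]
  have hU : 0 ≤ ∫ x, u x ^ 2 := integral_nonneg fun x => sq_nonneg _
  have hG : 0 ≤ ∫ x, gradNorm u x ^ 2 := integral_nonneg fun x => sq_nonneg _
  have hsum : (∫ x, gradNorm u x ^ 2) + μ ^ 2 * (∫ x, u x ^ 2) = N ^ 2 := hN2.symm
  set U := ∫ x, u x ^ 2
  set G := ∫ x, gradNorm u x ^ 2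
  rw [hlog, hq2] at hb
  have e1 : 2 * π * q ^ 2 / (2 * (2 * π * q / N)) = N * q / 2 := by field_simp
  have e2 : (2 * π * q / N / 2 * G + 1 / (2 * N * μ⁻¹ ^ 2) * U) / (2 * π)
      = q / (2 * N) * G + 1 / (4 * π * N) * (μ ^ 2 * U) := by field_simp; ring
  have e3 : q / (2 * N) * G ≤ N * q / 2 := by
    calc q / (2 * N) * G ≤ q / (2 * N) * N ^ 2 := by
          gcongr
          nlinarith [mul_nonneg (sq_nonneg μ) hU]
      _ = N * q / 2 := by field_simp
  have e4 : 1 / (4 * π * N) * (μ ^ 2 * U) ≤ N / 2 := by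
    calc 1 / (4 * π * N) * (μ ^ 2 * U) ≤ 1 / (2 * N) * N ^ 2 := by
          gcongr
          · nlinarith [Real.pi_gt_three]
          · linarith
      _ = N / 2 := by field_simp
  rw [e1, e2] at hb
  linarith

/-- logarithmic inequality on the whole plane (Lemma 2.3). -/
theorem statement4 (α : ℝ) (hα : α ∈ Set.Ioo (0:ℝ) 1) (lam : ℝ)
    (hlam : 1 / (2 * π * α) < lam) :
    ∃ C : ℝ, 0 < C ∧ ∀ μ : ℝ, 0 < μ → μ ≤ 1 → ∀ u : Plane → ℝ,
      MemH1 u → IsHolder α u → u ≠ 0 →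
      supNorm u ^ 2 ≤
        lam * HmuSq μ u *
          Real.log (C + (8:ℝ) ^ α * μ ^ (-α) * holderNorm α u / Real.sqrt (HmuSq μ u)) := by
  have hα0 : 0 < α := hα.1
  set lam₀ := 1 / (2 * π * α) with hlam₀
  have hlam₀_pos : 0 < lam₀ := by positivity
  obtain ⟨lam₁, h01, h1⟩ := exists_between hlam
  set ε := lam₁ / lam₀ - 1 with hε
  have hε0 : 0 < ε := sub_pos.2 ((one_lt_div hlam₀_pos).2 h01)
  set K := (1 + ε) * Real.log 2 / (2 * π) + 4 * (1 + 1 / ε) with hK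
  have hK0 : 0 < K := by
    have := Real.log_pos one_lt_two
    positivity
  have hd : 0 < lam - lam₁ := sub_pos.2 h1
  refine ⟨Real.exp (K / (lam - lam₁)), Real.exp_pos _, ?_⟩
  intro μ hμ _ u hu hh hne
  have hmain := supNorm_le_sqrt_log hα0 hμ hu hh hne
  have hH := HmuSq_pos hu hne hμ
  set N := √(HmuSq μ u)
  have hN : 0 < N := Real.sqrt_pos.2 hH
  have hN2 : HmuSq μ u = N ^ 2 := (Real.sq_sqrt hH.le).symm
  set X := μ ^ (-α) * holderNorm α u / N with hX
  have hX0 : 0 ≤ X := by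
    have : 0 ≤ holderNorm α u := add_nonneg (supNorm_nonneg u) (holderSemi_nonneg α u)
    positivity
  set Y := max 1 X with hYdef
  have hY1 : 1 ≤ Y := le_max_left _ _
  set Z := Real.exp (K / (lam - lam₁)) + (8 : ℝ) ^ α * μ ^ (-α) * holderNorm α u / N with hZ
  have hZX : (8 : ℝ) ^ α * μ ^ (-α) * holderNorm α u / N = (8 : ℝ) ^ α * X := by
    rw [hX]; ring
  have h8 : X ≤ (8 : ℝ) ^ α * X :=
    le_mul_of_one_le_left hX0 (Real.one_le_rpow (by norm_num) hα0.le)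
  have hC1 : 1 ≤ Real.exp (K / (lam - lam₁)) := Real.one_le_exp (by positivity)
  have hYZ : Y ≤ Z := max_le (by linarith) (by linarith)
  have hlogYZ : Real.log Y ≤ Real.log Z := Real.log_le_log (by linarith) hYZ
  have hKZ : K ≤ (lam - lam₁) * Real.log Z := by
    rw [mul_comm, ← div_le_iff₀ hd, Real.le_log_iff_exp_le (by linarith)]
    linarith
  set q := √((Real.log 2 + Real.log Y / α) / (2 * π)) with hq
  have hq2 : q ^ 2 = (Real.log 2 + Real.log Y / α) / (2 * π) := by
    have := Real.log_nonneg hY1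
    have := Real.log_pos one_lt_two
    exact Real.sq_sqrt (by positivity)
  have hyoung : (2 + q) ^ 2 ≤ (1 + ε) * q ^ 2 + 4 * (1 + 1 / ε) := by
    have h2 : (1 + ε) * q ^ 2 + 4 * (1 + 1 / ε) - (2 + q) ^ 2 = (ε * q - 2) ^ 2 / ε := by
      field_simp; ring
    have h3 : 0 ≤ (ε * q - 2) ^ 2 / ε := by positivity
    linarith
  have hexp : (1 + ε) * q ^ 2 + 4 * (1 + 1 / ε) = lam₁ * Real.log Y + K := by
    have : 1 + ε = lam₁ * (2 * π * α) := by rw [hε, hlam₀]; field_simp; ring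
    rw [hq2, hK, this]
    field_simp
    ring
  calc supNorm u ^ 2 ≤ (N * (2 + q)) ^ 2 := by
        gcongr
        exact supNorm_nonneg u
    _ = N ^ 2 * (2 + q) ^ 2 := by ring
    _ ≤ N ^ 2 * (lam * Real.log Z) := by
        gcongr
        have := mul_le_mul_of_nonneg_left hlogYZ (hlam₀_pos.trans h01).le
        linarith
    _ = lam * HmuSq μ u * Real.log Z := by rw [hN2]; ring
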